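/- Let ε = 1 or ε = −1, b ∈ ℝ with εb > 0, a ∈ ℂ, and let S ⊆ ℂ ∖ {0} be open. Let u : ℂ → ℂ be analytic on S with u(τ) ≠ 0 for all τ ∈ S, and suppose u satisfies the degenerate third Painlevé equation dP3(a, ε, b) on S. Define u₊(τ) := −(iεb/(8·u(τ)²))·(τ·(u'(τ) + ib) + (2ai − 1)·u(τ)), and assume u₊(τ) ≠ 0 for all τ ∈ S. Then the inverse Bäcklund transformation applied to u₊ with parameter a + i recovers u: for all τ ∈ S, (iεb/(8·u₊(τ)²))·(τ·(u₊'(τ) − ib) − (2ai − 1)·u₊(τ)) = u(τ). (Here 2(a+i)i + 1 = 2ai − 1.) -/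

import Mathlib

open Complex

/-- The degenerate third Painlevé equation `dP3(a, ε, b)` at the point `τ`. -/
def IsDP3At (a : ℂ) (ε b : ℝ) (u : ℂ → ℂ) (τ : ℂ) : Prop :=
  deriv (deriv u) τ =
    (deriv u τ) ^ 2 / u τ - deriv u τ / τ +
      (-8 * (ε : ℂ) * (u τ) ^ 2 + 2 * a * (b : ℂ)) / τ + (b : ℂ) ^ 2 / u τ

/-- The inverse Bäcklund transformation (2.5) applied to the Bäcklund transform `u₊`
(with parameter `a + i`) recovers the original solution `u`. -/
theorem backlund_inverse
    (ε b : ℝ) (hε : ε = 1 ∨ ε = -1) (hεb : ε * b > 0) (a : ℂ)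
    (S : Set ℂ) (hS : IsOpen S) (hS0 : S ⊆ {(0 : ℂ)}ᶜ)
    (u : ℂ → ℂ)
    (hu : ∀ τ ∈ S, AnalyticAt ℂ u τ)
    (hune : ∀ τ ∈ S, u τ ≠ 0)
    (heq : ∀ τ ∈ S, IsDP3At a ε b u τ)
    (up : ℂ → ℂ)
    (hup : ∀ τ, up τ = -(I * (ε : ℂ) * (b : ℂ) / (8 * (u τ) ^ 2)) *
      (τ * (deriv u τ + I * (b : ℂ)) + (2 * a * I - 1) * u τ))
    (hupne : ∀ τ ∈ S, up τ ≠ 0) :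
    ∀ τ ∈ S, I * (ε : ℂ) * (b : ℂ) / (8 * (up τ) ^ 2) *
      (τ * (deriv up τ - I * (b : ℂ)) - (2 * a * I - 1) * up τ) = u τ := by
  intro τ hτ
  have h0 : τ ≠ 0 := by simpa using hS0 hτ
  have hu0 := hune τ hτ
  have hb : (b : ℂ) ≠ 0 := by
    rintro h
    rw [Complex.ofReal_eq_zero] at h
    simp [h] at hεb
  have hε2 : (ε : ℂ) ^ 2 = 1 := by rcases hε with h | h <;> simp [h]
  have hε0 : (ε : ℂ) ≠ 0 := by
    rintro h
    simp [h] at hε2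
  have hd : HasDerivAt u (deriv u τ) τ := (hu τ hτ).differentiableAt.hasDerivAt
  have hdd : HasDerivAt (deriv u) (deriv (deriv u) τ) τ :=
    (hu τ hτ).deriv.differentiableAt.hasDerivAt
  have hE : τ * u τ * deriv (deriv u) τ = τ * deriv u τ ^ 2 - u τ * deriv u τ +
      u τ * (-8 * (ε : ℂ) * (u τ) ^ 2 + 2 * a * (b : ℂ)) + τ * (b : ℂ) ^ 2 := by
    rw [heq τ hτ]
    field_simp
  have hderiv : deriv up τ = -(I * ε * b / 8) *
      ((deriv u τ + I * b + τ * deriv (deriv u) τ + (2 * a * I - 1) * deriv u τ) / u τ ^ 2 -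
        2 * deriv u τ * (τ * (deriv u τ + I * b) + (2 * a * I - 1) * u τ) / u τ ^ 3) := by
    have hN : HasDerivAt (fun t => t * (deriv u t + I * b) + (2 * a * I - 1) * u t) _ τ :=
      ((hasDerivAt_id τ).mul (hdd.add_const (I * (b : ℂ)))).add
        (hd.const_mul (2 * a * I - 1))
    have hQ := (hN.div (hd.pow 2) (pow_ne_zero 2 hu0)).const_mul (-(I * ε * b / 8))
    have hfun : up = fun t => -(I * ε * b / 8) *
        ((t * (deriv u t + I * b) + (2 * a * I - 1) * u t) / u t ^ 2) := by
      funext t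
      rw [hup t, div_mul_eq_div_div]
      ring
    rw [hfun]
    refine (hQ.congr_deriv ?_).deriv
    simp only [id_eq, Pi.pow_apply, Nat.cast_ofNat, Nat.add_one_sub_one, pow_one, one_mul]
    field_simp
  have hkey : τ * (deriv up τ - I * b) - (2 * a * I - 1) * up τ =
      I * ε * b / 8 * (τ * (deriv u τ + I * b) + (2 * a * I - 1) * u τ) ^ 2 / u τ ^ 3 := by
    rw [hderiv, hup τ]
    field_simp
    linear_combination (-(ε : ℂ) * τ) * hE + 8 * τ * u τ ^ 3 * hε2 -
      (2 * τ * ε * b * a * u τ + τ ^ 2 * ε * b ^ 2) * I_sq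
  have hp := hupne τ hτ
  rw [hkey, div_mul_eq_mul_div, div_eq_iff (by simpa using hp), hup τ]
  field_simp
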